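/- arXiv:2505.22743 — 3 statements merged into one kernel-verified Lean document; each statement's English description precedes it below -/
import Mathlib

section
/- Purity controls marginal distinguishability for exact 2-design rotations: let n ≥ 1, d = 2^n, let ρ be a d-dimensional density matrix with p = tr(ρ²), and let ν be a finitely supported probability distribution on d×d unitaries satisfying E_{U∼ν}[(UρU^†)⊗(UρU^†)] = ((d−p)·I_{d²} + (dp−1)·S)/(d(d²−1)), where S is the swap on ℂ^d⊗ℂ^d (this is the value of this expectation for a Haar-random U, so the hypothesis holds for any exact unitary 2-design). Then for every A ⊆ [n]: E_{U∼ν} ‖ tr_{[n]∖A}(UρU^†) − 2^{−|A|}·I ‖₂² ≤ 2^{|A|−n}·( p − 2^{−n} ). -/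
open Matrix BigOperators Finset
open scoped ComplexOrder

/-- Partial trace over the tensor factors outside `T`. -/
noncomputable def ptrace {ι : Type*} [Fintype ι] [DecidableEq ι] {q : ℕ} (T : Finset ι)
    (M : Matrix (ι → Fin q) (ι → Fin q) ℂ) :
    Matrix ({i // i ∈ T} → Fin q) ({i // i ∈ T} → Fin q) ℂ :=
  Matrix.of fun a a' => ∑ b : {i // i ∉ T} → Fin q,
    M (fun i => if h : i ∈ T then a ⟨i, h⟩ else b ⟨i, h⟩)
      (fun i => if h : i ∈ T then a' ⟨i, h⟩ else b ⟨i, h⟩)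

/-- The tensor square `M ⊗ M` of a matrix, on the doubled index. -/
noncomputable def tsq {ι : Type*} (M : Matrix ι ι ℂ) : Matrix (ι × ι) (ι × ι) ℂ :=
  Matrix.of fun p q => M p.1 q.1 * M p.2 q.2

/-- The swap operator `S(u ⊗ v) = v ⊗ u` on `ℂ^ι ⊗ ℂ^ι`. -/
noncomputable def swapMat (ι : Type*) [DecidableEq ι] : Matrix (ι × ι) (ι × ι) ℂ :=
  Matrix.of fun p q => if p.1 = q.2 ∧ p.2 = q.1 then 1 else 0

/-- The squared Frobenius norm of a matrix. -/
noncomputable def frobSq {ι : Type*} [Fintype ι] (M : Matrix ι ι ℂ) : ℝ :=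
  ∑ a, ∑ b, ‖M a b‖ ^ 2

section Glue

variable {ι : Type*} [DecidableEq ι] {q : ℕ}

/-- The configuration on `ι` that agrees with `a` on `T` and with `b` off `T`. -/
def glue (T : Finset ι) (a : {i // i ∈ T} → Fin q) (b : {i // i ∉ T} → Fin q) : ι → Fin q :=
  fun i => if h : i ∈ T then a ⟨i, h⟩ else b ⟨i, h⟩

lemma glue_inj (T : Finset ι) {a a' : {i // i ∈ T} → Fin q} {b b' : {i // i ∉ T} → Fin q} :
    glue T a b = glue T a' b' ↔ a = a' ∧ b = b' := by
  have h := (Equiv.piEquivPiSubtypeProd (fun i => i ∈ T) (fun _ => Fin q)).symm.injective.eq_iff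
    (a := (a, b)) (b := (a', b'))
  rw [Prod.mk.injEq] at h
  exact h

variable [Fintype ι]

lemma ptrace_apply (T : Finset ι) (M : Matrix (ι → Fin q) (ι → Fin q) ℂ)
    (a a' : {i // i ∈ T} → Fin q) :
    ptrace T M a a' = ∑ b, M (glue T a b) (glue T a' b) := rfl

lemma trace_ptrace (T : Finset ι) (M : Matrix (ι → Fin q) (ι → Fin q) ℂ) :
    (ptrace T M).trace = M.trace := by
  simp only [Matrix.trace, Matrix.diag_apply, ptrace_apply]
  rw [← Fintype.sum_prod_type']
  exact Equiv.sum_comp (Equiv.piEquivPiSubtypeProd (fun i => i ∈ T) (fun _ => Fin q)).symm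
    (fun x => M x x)

lemma isHermitian_ptrace (T : Finset ι) {M : Matrix (ι → Fin q) (ι → Fin q) ℂ}
    (hM : M.IsHermitian) : (ptrace T M).IsHermitian := by
  ext a a'
  simp only [Matrix.conjTranspose_apply, ptrace_apply, star_sum, hM.apply]

/-- The linear functional on operators on the doubled space whose value at `M ⊗ M` is the purity
of the marginal of `M` on `T`. -/
noncomputable def marginalPurity (T : Finset ι) :
    Matrix ((ι → Fin q) × (ι → Fin q)) ((ι → Fin q) × (ι → Fin q)) ℂ →ₗ[ℂ] ℂ :=
  ∑ a, ∑ a', ∑ b, ∑ b',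
    Matrix.entryLinearMap ℂ ℂ (glue T a b, glue T a' b') (glue T a' b, glue T a b')

lemma marginalPurity_apply (T : Finset ι)
    (M : Matrix ((ι → Fin q) × (ι → Fin q)) ((ι → Fin q) × (ι → Fin q)) ℂ) :
    marginalPurity T M = ∑ a, ∑ a', ∑ b, ∑ b',
      M (glue T a b, glue T a' b') (glue T a' b, glue T a b') := by
  simp [marginalPurity, LinearMap.sum_apply]

lemma marginalPurity_tsq (T : Finset ι) (M : Matrix (ι → Fin q) (ι → Fin q) ℂ) :
    marginalPurity T (tsq M) = (ptrace T M * ptrace T M).trace := by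
  simp only [marginalPurity_apply, tsq, Matrix.of_apply, Matrix.trace, Matrix.diag_apply,
    Matrix.mul_apply, ptrace_apply, Finset.sum_mul_sum]

lemma marginalPurity_one (T : Finset ι) :
    marginalPurity (q := q) T 1 =
      (q : ℂ) ^ T.card * ((q : ℂ) ^ (Fintype.card ι - T.card)) ^ 2 := by
  simp [marginalPurity_apply, Matrix.one_apply, glue_inj, ite_and, Fintype.card_subtype_compl, pow_two]

lemma marginalPurity_swapMat (T : Finset ι) :
    marginalPurity (q := q) T (swapMat _) =
      ((q : ℂ) ^ T.card) ^ 2 * (q : ℂ) ^ (Fintype.card ι - T.card) := by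
  simp [marginalPurity_apply, swapMat, glue_inj, ite_and, Fintype.card_subtype_compl]
  ring

end Glue

lemma frobSq_eq_trace {ι : Type*} [Fintype ι] {M : Matrix ι ι ℂ} (hM : M.IsHermitian) :
    (frobSq M : ℂ) = (M * M).trace := by
  simp only [frobSq, Matrix.trace, Matrix.diag_apply, Matrix.mul_apply]
  push_cast
  refine Finset.sum_congr rfl fun a _ => Finset.sum_congr rfl fun b _ => ?_
  rw [← hM.apply b a, ← Complex.mul_conj']
  rfl

lemma frobSq_nonneg {ι : Type*} [Fintype ι] (M : Matrix ι ι ℂ) : 0 ≤ frobSq M := by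
  unfold frobSq
  positivity

lemma frobSq_sub_inv_card {ι : Type*} [Fintype ι] [DecidableEq ι] [Nonempty ι]
    {M : Matrix ι ι ℂ} (hM : M.IsHermitian) (htr : M.trace = 1) :
    (frobSq (M - (Fintype.card ι : ℂ)⁻¹ • 1) : ℂ)
      = (M * M).trace - (Fintype.card ι : ℂ)⁻¹ := by
  have hc : (Fintype.card ι : ℂ) ≠ 0 := by simp
  have hH : (M - (Fintype.card ι : ℂ)⁻¹ • 1).IsHermitian := by
    refine hM.sub ?_
    simp [Matrix.IsHermitian, Matrix.conjTranspose_smul]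
  rw [frobSq_eq_trace hH]
  simp only [sub_mul, mul_sub, Matrix.trace_sub, Matrix.smul_mul, Matrix.mul_smul, one_mul,
    mul_one, Matrix.trace_smul, Matrix.trace_one, htr, smul_eq_mul]
  field_simp
  ring

lemma trace_unitary_conj {ι : Type*} [Fintype ι] [DecidableEq ι] {V : Matrix ι ι ℂ}
    (hV : V ∈ Matrix.unitaryGroup ι ℂ) (M : Matrix ι ι ℂ) :
    (V * M * Vᴴ).trace = M.trace := by
  rw [Matrix.trace_mul_cycle, ← Matrix.star_eq_conjTranspose, Matrix.mem_unitaryGroup_iff'.1 hV,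
    one_mul]

/-- The expected squared distance of the marginal on `A` to the maximally mixed state. -/
lemma expected_marginal_distance (n : ℕ) (hn : 1 ≤ n) (p : ℝ)
    {J : Type*} [Fintype J] (w : J → ℝ) (hw1 : ∑ j, w j = 1)
    (X : J → Matrix (Fin n → Fin 2) (Fin n → Fin 2) ℂ)
    (hX : ∀ j, (X j).IsHermitian) (htr : ∀ j, (X j).trace = 1)
    (hmom : ∑ j, (w j : ℂ) • tsq (X j)
      = ((2 : ℂ) ^ n * (((2 : ℂ) ^ n) ^ 2 - 1))⁻¹ •
          ((((2 : ℝ) ^ n - p : ℝ) : ℂ) • 1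
            + (((2 : ℝ) ^ n * p - 1 : ℝ) : ℂ) • swapMat (Fin n → Fin 2)))
    (A : Finset (Fin n)) :
    ∑ j, w j * frobSq (ptrace A (X j) - ((2 : ℂ) ^ A.card)⁻¹ • 1)
      = ((2 : ℝ) ^ n * p - 1) * ((2 : ℝ) ^ A.card - ((2 : ℝ) ^ A.card)⁻¹)
          / (((2 : ℝ) ^ n) ^ 2 - 1) := by
  have hfrob : ∀ j, (frobSq (ptrace A (X j) - ((2 : ℂ) ^ A.card)⁻¹ • 1) : ℂ)
      = marginalPurity A (tsq (X j)) - ((2 : ℂ) ^ A.card)⁻¹ := by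
    intro j
    have h := frobSq_sub_inv_card (isHermitian_ptrace A (hX j)) ((trace_ptrace A _).trans (htr j))
    rw [marginalPurity_tsq]
    simpa using h
  have hL := congrArg (marginalPurity A) hmom
  simp only [map_sum, map_smul, map_add, marginalPurity_one, marginalPurity_swapMat,
    smul_eq_mul, Fintype.card_fin, Nat.cast_ofNat] at hL
  have hcard : A.card ≤ n := by simpa using A.card_le_univ
  have hd : (2 : ℝ) ^ n = 2 ^ A.card * 2 ^ (n - A.card) := by
    rw [← pow_add, Nat.add_sub_cancel' hcard]
  have hd1 : ((2 : ℝ) ^ n) ^ 2 - 1 ≠ 0 := by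
    have : (1 : ℝ) < 2 ^ n := one_lt_pow₀ (by norm_num) (by omega)
    nlinarith
  have hw1' : ∑ j, (w j : ℂ) = 1 := by exact_mod_cast hw1
  have hC : ((∑ j, w j * frobSq (ptrace A (X j) - ((2 : ℂ) ^ A.card)⁻¹ • 1) : ℝ) : ℂ)
      = (((((2 : ℝ) ^ n * (((2 : ℝ) ^ n) ^ 2 - 1))⁻¹ *
          (((2 : ℝ) ^ n - p) * (2 ^ A.card * (2 ^ (n - A.card)) ^ 2)
            + ((2 : ℝ) ^ n * p - 1) * ((2 ^ A.card) ^ 2 * 2 ^ (n - A.card)))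
          - ((2 : ℝ) ^ A.card)⁻¹ : ℝ)) : ℂ) := by
    push_cast at hL ⊢
    simp only [hfrob, mul_sub, Finset.sum_sub_distrib, ← Finset.sum_mul, hw1', one_mul, hL]
  rw [Complex.ofReal_inj.1 hC]
  have hD : (0 : ℝ) < 2 ^ A.card := by positivity
  have hE : (0 : ℝ) < 2 ^ (n - A.card) := by positivity
  rw [hd, mul_pow] at hd1
  rw [hd, mul_pow]
  generalize (2 : ℝ) ^ A.card = D at *
  generalize (2 : ℝ) ^ (n - A.card) = E at *
  field_simp
  ring

/-- purity controls marginal distinguishability for exact 2-design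
rotations. -/
theorem purity_controls_marginal_distinguishability
    (n : ℕ) (hn : 1 ≤ n) (p : ℝ)
    (ρ : Matrix (Fin n → Fin 2) (Fin n → Fin 2) ℂ)
    (hρ : ρ.PosSemidef) (htrρ : ρ.trace = 1) (hp : (ρ * ρ).trace = (p : ℂ))
    (J : Type) [Fintype J] (w : J → ℝ) (hw0 : ∀ j, 0 ≤ w j) (hw1 : ∑ j, w j = 1)
    (U : J → Matrix (Fin n → Fin 2) (Fin n → Fin 2) ℂ)
    (hU : ∀ j, U j ∈ Matrix.unitaryGroup (Fin n → Fin 2) ℂ)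
    (hmom : ∑ j, (w j : ℂ) • tsq (U j * ρ * (U j)ᴴ)
      = ((2 : ℂ) ^ n * (((2 : ℂ) ^ n) ^ 2 - 1))⁻¹ •
          ((((2 : ℝ) ^ n - p : ℝ) : ℂ) •
              (1 : Matrix ((Fin n → Fin 2) × (Fin n → Fin 2))
                ((Fin n → Fin 2) × (Fin n → Fin 2)) ℂ)
            + (((2 : ℝ) ^ n * p - 1 : ℝ) : ℂ) • swapMat (Fin n → Fin 2))) :
    ∀ A : Finset (Fin n),
      ∑ j, w j * frobSq (ptrace A (U j * ρ * (U j)ᴴ) - ((2 : ℂ) ^ A.card)⁻¹ • 1)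
        ≤ (2 : ℝ) ^ A.card / 2 ^ n * (p - ((2 : ℝ) ^ n)⁻¹) := by
  intro A
  have hX : ∀ j, (U j * ρ * (U j)ᴴ).IsHermitian := fun j =>
    Matrix.isHermitian_mul_mul_conjTranspose (U j) hρ.isHermitian
  have htr : ∀ j, (U j * ρ * (U j)ᴴ).trace = 1 := fun j =>
    (trace_unitary_conj (hU j) ρ).trans htrρ
  have key := expected_marginal_distance n hn p w hw1 _ hX htr hmom
  have hd : (1 : ℝ) < 2 ^ n := one_lt_pow₀ (by norm_num) (by omega)
  have hd1 : (0 : ℝ) < ((2 : ℝ) ^ n) ^ 2 - 1 := by nlinarith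
  have hDd : (2 : ℝ) ^ A.card ≤ 2 ^ n :=
    pow_le_pow_right₀ (by norm_num) (by simpa using A.card_le_univ)
  have hD : (0 : ℝ) < 2 ^ A.card := by positivity
  have hpurity : 0 ≤ (2 : ℝ) ^ n * p - 1 := by
    have h0 := (Finset.sum_nonneg fun j _ => mul_nonneg (hw0 j) (frobSq_nonneg _)).trans_eq
      (key Finset.univ)
    rw [Finset.card_univ, Fintype.card_fin] at h0
    have hfac : (0 : ℝ) < 2 ^ n - ((2 : ℝ) ^ n)⁻¹ :=
      sub_pos.2 ((inv_lt_one_of_one_lt₀ hd).trans hd)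
    exact nonneg_of_mul_nonneg_left (by rwa [le_div_iff₀ hd1, zero_mul] at h0) hfac
  rw [key A]
  generalize (2 : ℝ) ^ A.card = D at *
  generalize (2 : ℝ) ^ n = d at *
  have hrhs : D / d * (p - d⁻¹) = (d * p - 1) * (D / d ^ 2) := by
    field_simp
  rw [hrhs, mul_div_assoc]
  refine mul_le_mul_of_nonneg_left ?_ hpurity
  have hsub : D - D⁻¹ = (D ^ 2 - 1) / D := by field_simp
  rw [hsub, div_div, div_le_div_iff₀ (by positivity) (by positivity)]
  nlinarith [mul_self_le_mul_self hD.le hDd]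
end

section
/- Correlated quadratic-form product bound for centered design moments: let d ≥ 1, let W be a finite set of size t ≥ 1, for each w ∈ W let (ψ^w_x)_{x ∈ [d]} be an orthonormal basis of ℂ^d, and let a ≥ 1. Let ν be a finitely supported probability distribution on Hermitian d×d matrices Δ satisfying E_ν[(dΔ)^{⊗t}] = Σ_{π ∈ S_W} γ_{|fix(π)|} · P_π for real numbers γ_0, …, γ_t with |γ_0| ≤ 1 and |γ_f| ≤ (a/√d)^f for all 1 ≤ f ≤ t, where P_π permutes the tensor factors of (ℂ^d)^{⊗W} and fix(π) is the fixed-point set of π. For Hermitian Δ, Δ' define C_w(Δ,Δ') = (1/d)·Σ_{x ∈ [d]} ⟨ψ^w_x, dΔ ψ^w_x⟩·⟨ψ^w_x, dΔ' ψ^w_x⟩. Then for Δ, Δ' drawn independently from ν, E[ ∏_{w ∈ W} C_w(Δ,Δ') ] ≤ (t!)² · (a²/√d)^t. -/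
open Matrix BigOperators Finset

/-- `φ` is an orthonormal basis of `ℂ^ι`. -/
def IsONB {ι : Type*} [Fintype ι] [DecidableEq ι] (φ : ι → ι → ℂ) : Prop :=
  ∀ s t, star (φ s) ⬝ᵥ φ t = if s = t then 1 else 0

/-- The tensor power of a `d × d` matrix over the factors indexed by `W`. -/
noncomputable def tpowW {d : ℕ} {W : Type*} [Fintype W] (M : Matrix (Fin d) (Fin d) ℂ) :
    Matrix (W → Fin d) (W → Fin d) ℂ :=
  Matrix.of fun f g => ∏ w, M (f w) (g w)

/-- The operator permuting the tensor factors of `(ℂ^d)^{⊗W}` according to `π`. -/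
noncomputable def permMatW {d : ℕ} {W : Type*} [Fintype W] [DecidableEq W]
    (π : Equiv.Perm W) : Matrix (W → Fin d) (W → Fin d) ℂ :=
  Matrix.of fun f g => if ∀ w, f (π w) = g w then 1 else 0

/-- Number of fixed points of a permutation. -/
def fixCountW {W : Type*} [Fintype W] [DecidableEq W] (π : Equiv.Perm W) : ℕ :=
  (Finset.univ.filter fun w => π w = w).card

/-- A permutation has a set of points containing all fixed points, meeting the orbit neighbourhood of
every other point, and of size at most the average of the number of points and of fixed points. -/
theorem exists_dominating_finset {W : Type*} [Fintype W] [DecidableEq W] (σ : Equiv.Perm W) :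
    ∃ S : Finset W, 2 * S.card ≤ Fintype.card W + fixCountW σ ∧
      ∀ w, w ∉ S → σ w ∈ S ∨ σ.symm w ∈ S := by
  classical
  set F : Finset W := Finset.univ.filter fun w => σ w = w with hF
  have hFc : fixCountW σ = F.card := rfl
  let P : Finset W → Prop := fun I => ∀ v ∈ I, σ v ∉ I
  obtain ⟨I, hI⟩ := (Set.toFinite {I : Finset W | P I}).exists_maximal
    ⟨∅, by simp [P]⟩
  have hInd : ∀ v ∈ I, σ v ∉ I := hI.prop
  have hdisj : Disjoint I F := by
    rw [Finset.disjoint_left]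
    intro w hw hf
    have := hInd w hw
    simp only [hF, Finset.mem_filter, Finset.mem_univ, true_and] at hf
    rw [hf] at this
    exact this hw
  have h1 : ∀ w, w ∉ I ∪ F → σ w ∈ I ∪ F ∨ σ.symm w ∈ I ∪ F := by
    intro w hw
    by_contra! hcon
    simp only [Finset.mem_union, not_or] at hw hcon
    obtain ⟨hwI, hwF⟩ := hw
    have hne : σ w ≠ w := by simpa [hF] using hwF
    have hins : P (insert w I) := by
      intro v hv hσv
      rw [Finset.mem_insert] at hv hσv
      rcases hv with rfl | hv
      · rcases hσv with h | h
        · exact hne h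
        · exact hcon.1.1 h
      · rcases hσv with h | h
        · apply hcon.2.1
          rw [← h]
          simpa using hv
        · exact hInd v hv h
    exact hwI (hI.le_of_ge hins (Finset.subset_insert w I) (Finset.mem_insert_self w I))
  have h2 : ∀ w, w ∉ Iᶜ → σ w ∈ Iᶜ ∨ σ.symm w ∈ Iᶜ := by
    intro w hw
    left
    simp only [Finset.mem_compl, not_not] at hw ⊢
    exact hInd w hw
  have hc1 : (I ∪ F).card = I.card + F.card := Finset.card_union_of_disjoint hdisj
  have hc2 : Iᶜ.card + I.card = Fintype.card W := by
    rw [Finset.card_compl]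
    have := Finset.card_le_univ I
    omega
  by_cases hle : 2 * (I ∪ F).card ≤ Fintype.card W + fixCountW σ
  · exact ⟨I ∪ F, hle, h1⟩
  · exact ⟨Iᶜ, by omega, h2⟩

/-- Summing out all variables outside `S`, each coupled by a stochastic kernel to a variable in `S`. -/
theorem sum_prod_kernel_eq {d : ℕ} {W : Type*} [Fintype W] [DecidableEq W] (S : Finset W)
    (p : W → W) (hp : ∀ w, w ∉ S → p w ∈ S) (K : W → Fin d → Fin d → ℝ)
    (hK : ∀ w, w ∉ S → ∀ j, ∑ i, K w i j = 1) :
    ∑ x : W → Fin d, ∏ w ∈ Sᶜ, K w (x w) (x (p w)) = (d : ℝ) ^ S.card := by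
  classical
  have hprod : ∀ x : W → Fin d, ∏ w ∈ Sᶜ, K w (x w) (x (p w))
      = ∏ w : {w // w ∉ S}, K w (x w) (x (p w)) := by
    intro x
    exact Finset.prod_subtype _ (by simp) _
  simp_rw [hprod]
  rw [← (Equiv.piEquivPiSubtypeProd (fun w => w ∈ S) (fun _ => Fin d)).symm.sum_comp,
    Fintype.sum_prod_type]
  have hin : ∀ y : {w // w ∈ S} → Fin d,
      ∑ z : {w // w ∉ S} → Fin d, ∏ w : {w // w ∉ S},
        K w (z w) (y ⟨p w, hp w w.2⟩) = 1 := by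
    intro y
    rw [← Fintype.prod_sum (fun (w : {w // w ∉ S}) i => K w i (y ⟨p w, hp w w.2⟩))]
    exact Finset.prod_eq_one fun w _ => hK w w.2 _
  calc _ = ∑ y : {w // w ∈ S} → Fin d, (1 : ℝ) := by
        refine Finset.sum_congr rfl fun y _ => ?_
        rw [← hin y]
        refine Finset.sum_congr rfl fun z _ => Finset.prod_congr rfl fun w _ => ?_
        have hw := w.2
        have hpw := hp w w.2
        simp [Equiv.piEquivPiSubtypeProd, hw, hpw]
    _ = _ := by simp

/-- The sum of products of doubly stochastic kernels along the orbits of a permutation. -/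
theorem sum_prod_doublyStochastic_le {d : ℕ} {W : Type*} [Fintype W] [DecidableEq W]
    (σ : Equiv.Perm W) (B : W → Fin d → Fin d → ℝ) (h0 : ∀ w i j, 0 ≤ B w i j)
    (hrow : ∀ w i, ∑ j, B w i j = 1) (hcol : ∀ w j, ∑ i, B w i j = 1) :
    ∃ n : ℕ, 2 * n ≤ Fintype.card W + fixCountW σ ∧
      ∑ x : W → Fin d, ∏ w, B w (x w) (x (σ w)) ≤ (d : ℝ) ^ n := by
  classical
  obtain ⟨S, hS, hdom⟩ := exists_dominating_finset σ
  refine ⟨S.card, hS, ?_⟩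
  have h1 : ∀ w i j, B w i j ≤ 1 := fun w i j => by
    rw [← hrow w i]
    exact Finset.single_le_sum (fun j _ => h0 w i j) (Finset.mem_univ j)
  let p : W → W := fun w => if σ w ∈ S then σ w else σ.symm w
  let e : W → W := fun w => if σ w ∈ S then w else σ.symm w
  let K : W → Fin d → Fin d → ℝ := fun w i j =>
    if σ w ∈ S then B w i j else B (σ.symm w) j i
  have hp : ∀ w, w ∉ S → p w ∈ S := by
    intro w hw
    by_cases h : σ w ∈ S
    · simp [p, h]
    · simpa [p, h] using (hdom w hw).resolve_left h
  have hK : ∀ w, w ∉ S → ∀ j, ∑ i, K w i j = 1 := by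
    intro w _ j
    by_cases h : σ w ∈ S
    · simpa [K, h] using hcol w j
    · simpa [K, h] using hrow (σ.symm w) j
  have he : Set.InjOn e (Sᶜ : Finset W) := by
    intro v hv w hw hvw
    simp only [Finset.coe_compl, Set.mem_compl_iff, Finset.mem_coe] at hv hw
    have hv' := hdom v hv
    have hw' := hdom w hw
    by_cases h : σ v ∈ S <;> by_cases h' : σ w ∈ S <;> simp only [e, h, h', if_true, if_false] at hvw
    · exact hvw
    · exact absurd (hvw ▸ hw'.resolve_left h') hv
    · exact absurd (hvw ▸ hv'.resolve_left h) hw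
    · exact σ.symm.injective hvw
  rw [← sum_prod_kernel_eq S p hp K hK]
  refine Finset.sum_le_sum fun x _ => ?_
  calc ∏ w, B w (x w) (x (σ w))
      ≤ ∏ w ∈ Sᶜ.image e, B w (x w) (x (σ w)) := by
        rw [← Finset.prod_mul_prod_compl (Sᶜ.image e)]
        exact mul_le_of_le_one_right (Finset.prod_nonneg fun _ _ => h0 _ _ _)
          (Finset.prod_le_one (fun _ _ => h0 _ _ _) fun _ _ => h1 _ _ _)
    _ = ∏ w ∈ Sᶜ, B (e w) (x (e w)) (x (σ (e w))) := Finset.prod_image he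
    _ = ∏ w ∈ Sᶜ, K w (x w) (x (p w)) := by
        refine Finset.prod_congr rfl fun w _ => ?_
        by_cases h : σ w ∈ S <;> simp [e, K, p, h]

theorem IsONB.sum_norm_sq {ι : Type*} [Fintype ι] [DecidableEq ι] {φ : ι → ι → ℂ} (h : IsONB φ)
    (v : ι → ℂ) : ((∑ i, ‖star (φ i) ⬝ᵥ v‖ ^ 2 : ℝ) : ℂ) = star v ⬝ᵥ v := by
  let U : Matrix ι ι ℂ := Matrix.of fun i k => star (φ i k)
  have hU : U * Uᴴ = 1 := by
    ext s t
    rw [Matrix.one_apply, ← h s t]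
    simp [U, Matrix.mul_apply, dotProduct]
  have hU' : Uᴴ * U = 1 := mul_eq_one_comm.mp hU
  have hv : ∀ i, star (φ i) ⬝ᵥ v = (U *ᵥ v) i := fun i => rfl
  calc ((∑ i, ‖star (φ i) ⬝ᵥ v‖ ^ 2 : ℝ) : ℂ) = star (U *ᵥ v) ⬝ᵥ (U *ᵥ v) := by
        simp only [hv]
        push_cast
        refine Finset.sum_congr rfl fun i _ => ?_
        rw [← Complex.conj_mul']
        rfl
    _ = star v ⬝ᵥ v := by
        rw [Matrix.star_mulVec, ← Matrix.dotProduct_mulVec, Matrix.mulVec_mulVec, hU',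
          Matrix.one_mulVec]

theorem IsONB.sum_norm_sq_left {ι : Type*} [Fintype ι] [DecidableEq ι] {φ χ : ι → ι → ℂ}
    (h : IsONB φ) (h' : IsONB χ) (j : ι) : ∑ i, ‖star (φ i) ⬝ᵥ χ j‖ ^ 2 = 1 := by
  have := h.sum_norm_sq (χ j)
  rw [h' j j, if_pos rfl] at this
  exact_mod_cast this

theorem IsONB.sum_norm_sq_right {ι : Type*} [Fintype ι] [DecidableEq ι] {φ χ : ι → ι → ℂ}
    (h : IsONB φ) (h' : IsONB χ) (i : ι) : ∑ j, ‖star (φ i) ⬝ᵥ χ j‖ ^ 2 = 1 := by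
  rw [← h'.sum_norm_sq_left h i]
  refine Finset.sum_congr rfl fun j _ => ?_
  rw [← norm_star, Matrix.star_dotProduct, star_star, dotProduct_comm]

/-- The quadratic form of a tensor power at a product vector. -/
theorem quadForm_tpowW {d : ℕ} {W : Type*} [Fintype W] [DecidableEq W]
    (M : Matrix (Fin d) (Fin d) ℂ) (v : W → Fin d → ℂ) :
    (star fun f : W → Fin d => ∏ w, v w (f w)) ⬝ᵥ (tpowW M *ᵥ fun f => ∏ w, v w (f w))
      = ∏ w, star (v w) ⬝ᵥ (M *ᵥ v w) := by
  have hrow : ∀ f : W → Fin d, (tpowW M *ᵥ fun f => ∏ w, v w (f w)) f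
      = ∏ w, (M *ᵥ v w) (f w) := by
    intro f
    simp only [mulVec, dotProduct, tpowW, Matrix.of_apply, ← Finset.prod_mul_distrib,
      Fintype.prod_sum]
  simp only [dotProduct, hrow, Pi.star_apply, star_prod, ← Finset.prod_mul_distrib,
    Fintype.prod_sum]

/-- The quadratic form of a tensor permutation at a product vector. -/
theorem quadForm_permMatW {d : ℕ} {W : Type*} [Fintype W] [DecidableEq W]
    (π : Equiv.Perm W) (v : W → Fin d → ℂ) :
    (star fun f : W → Fin d => ∏ w, v w (f w)) ⬝ᵥ (permMatW π *ᵥ fun f => ∏ w, v w (f w))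
      = ∏ w, star (v w) ⬝ᵥ v (π.symm w) := by
  have hrow : ∀ f : W → Fin d, (permMatW π *ᵥ fun f => ∏ w, v w (f w)) f
      = ∏ w, v (π.symm w) (f w) := by
    intro f
    have hiff : ∀ g : W → Fin d, (∀ w, f (π w) = g w) ↔ (fun w => f (π w)) = g :=
      fun g => funext_iff.symm
    simp only [mulVec, dotProduct, permMatW, Matrix.of_apply, hiff, ite_mul, one_mul, zero_mul,
      Finset.sum_ite_eq, Finset.mem_univ, if_true]
    rw [← Equiv.prod_comp π (fun w => v (π.symm w) (f w))]
    simp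
  simp only [dotProduct, hrow, Pi.star_apply, star_prod, ← Finset.prod_mul_distrib,
    Fintype.prod_sum]

theorem quadForm_re_of_isHermitian {n : Type*} [Fintype n] {M : Matrix n n ℂ} (h : M.IsHermitian)
    (v : n → ℂ) : (((star v ⬝ᵥ (M *ᵥ v)).re : ℝ) : ℂ) = star v ⬝ᵥ (M *ᵥ v) := by
  apply Complex.ext
  · simp
  · simpa using (h.im_star_dotProduct_mulVec_self v).symm

theorem fixCountW_symm {W : Type*} [Fintype W] [DecidableEq W] (π : Equiv.Perm W) :
    fixCountW π.symm = fixCountW π := by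
  unfold fixCountW
  congr 1
  ext w
  simp only [Finset.mem_filter, Finset.mem_univ, true_and, Equiv.symm_apply_eq]
  exact eq_comm

theorem design_term_le {d t f n : ℕ} (hd : 1 ≤ d) {a g : ℝ} (ha : 1 ≤ a) (hf : f ≤ t)
    (hn : 2 * n ≤ t + f) (hg : |g| ≤ (a / Real.sqrt d) ^ f) :
    (1 / (d : ℝ)) ^ t * (g ^ 2 * (d : ℝ) ^ n) ≤ (a ^ 2 / Real.sqrt d) ^ t := by
  have hs : 1 ≤ Real.sqrt d := Real.one_le_sqrt.mpr (by exact_mod_cast hd)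
  have hds : (d : ℝ) = Real.sqrt d ^ 2 := (Real.sq_sqrt (Nat.cast_nonneg d)).symm
  rw [hds, Real.sqrt_sq (Real.sqrt_nonneg _)]
  generalize Real.sqrt d = s at *
  have hs0 : 0 < s := by linarith
  have hg2 : g ^ 2 ≤ ((a / s) ^ f) ^ 2 := sq_le_sq' (by linarith [abs_le.mp hg]) (abs_le.mp hg).2
  calc (1 / s ^ 2) ^ t * (g ^ 2 * (s ^ 2) ^ n)
      ≤ (1 / s ^ 2) ^ t * (((a / s) ^ f) ^ 2 * (s ^ 2) ^ n) := by gcongr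
    _ = (a ^ 2) ^ f * (s ^ (2 * n) / s ^ (2 * t + 2 * f)) := by
        rw [div_pow, div_pow, div_pow, one_pow, pow_add, ← pow_mul, ← pow_mul, ← pow_mul, ← pow_mul,
          ← pow_mul, mul_comm f 2]
        field_simp
    _ ≤ (a ^ 2) ^ t * (1 / s ^ t) := by
        gcongr ?_ * ?_
        · exact pow_le_pow_right₀ (one_le_pow₀ ha) hf
        · rw [div_le_div_iff₀ (by positivity) (by positivity), one_mul, ← pow_add]
          exact pow_le_pow_right₀ hs (by omega)
    _ = (a ^ 2 / s) ^ t := by rw [div_pow]; ring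

/-- Expanding the average over two independent copies of a product of averaged correlations. -/
theorem sum_sum_mul_prod_eq {J W X : Type*} [Fintype J] [Fintype W] [DecidableEq W] [Fintype X]
    (c : ℝ) (p : J → ℝ) (q : J → W → X → ℝ) :
    ∑ j, ∑ j', p j * p j' * ∏ w, (c * ∑ x, q j w x * q j' w x)
      = c ^ Fintype.card W * ∑ x : W → X, (∑ j, p j * ∏ w, q j w (x w)) ^ 2 := by
  simp_rw [Finset.prod_mul_distrib, Finset.prod_const, Finset.card_univ, Fintype.prod_sum,
    Finset.prod_mul_distrib, sq, Finset.sum_mul_sum, Finset.mul_sum]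
  rw [Finset.sum_comm_cycle]
  refine Finset.sum_congr rfl fun x _ => ?_
  refine Finset.sum_congr rfl fun j _ => Finset.sum_congr rfl fun j' _ => ?_
  ring

/-- correlated quadratic-form product bound for centered design moments. -/
theorem correlated_quadform_product_bound
    (d : ℕ) (hd : 1 ≤ d) (W : Type) [Fintype W] [DecidableEq W]
    (ht : 1 ≤ Fintype.card W)
    (ψ : W → Fin d → Fin d → ℂ) (hψ : ∀ w, IsONB (ψ w))
    (a : ℝ) (ha : 1 ≤ a)
    (J : Type) [Fintype J] (wgt : J → ℝ) (hw0 : ∀ j, 0 ≤ wgt j) (hw1 : ∑ j, wgt j = 1)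
    (Δ : J → Matrix (Fin d) (Fin d) ℂ) (hherm : ∀ j, (Δ j).IsHermitian)
    (γ : ℕ → ℝ) (hγ0 : |γ 0| ≤ 1)
    (hγ : ∀ f : ℕ, 1 ≤ f → f ≤ Fintype.card W → |γ f| ≤ (a / Real.sqrt d) ^ f)
    (hmom : ∑ j, (wgt j : ℂ) • tpowW (W := W) ((d : ℂ) • Δ j)
      = ∑ π : Equiv.Perm W, ((γ (fixCountW π) : ℝ) : ℂ) • permMatW π) :
    ∑ j, ∑ j', wgt j * wgt j' *
        ∏ w : W,
          ((1 / (d : ℝ)) * ∑ x : Fin d,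
            (star (ψ w x) ⬝ᵥ (((d : ℂ) • Δ j) *ᵥ ψ w x)).re *
            (star (ψ w x) ⬝ᵥ (((d : ℂ) • Δ j') *ᵥ ψ w x)).re)
      ≤ ((Fintype.card W).factorial : ℝ) ^ 2 *
          (a ^ 2 / Real.sqrt d) ^ (Fintype.card W) := by
  set t := Fintype.card W
  set q : J → W → Fin d → ℝ := fun j w x =>
    (star (ψ w x) ⬝ᵥ (((d : ℂ) • Δ j) *ᵥ ψ w x)).re with hq
  set c : Equiv.Perm W → (W → Fin d) → ℂ := fun π x =>
    ∏ w, star (ψ w (x w)) ⬝ᵥ ψ (π.symm w) (x (π.symm w)) with hc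
  have hqC : ∀ j w x, ((q j w x : ℝ) : ℂ) = star (ψ w x) ⬝ᵥ (((d : ℂ) • Δ j) *ᵥ ψ w x) := by
    intro j w x
    refine quadForm_re_of_isHermitian ?_ _
    rw [Matrix.IsHermitian, Matrix.conjTranspose_smul, (hherm j).eq]
    simp
  have hE : ∀ x : W → Fin d, ((∑ j, wgt j * ∏ w, q j w (x w) : ℝ) : ℂ)
      = ∑ π, ((γ (fixCountW π) : ℝ) : ℂ) * c π x := by
    intro x
    have h := congrArg (fun M => (star fun f : W → Fin d => ∏ w, ψ w (x w) (f w)) ⬝ᵥ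
      (M *ᵥ fun f => ∏ w, ψ w (x w) (f w))) hmom
    simp only [Matrix.sum_mulVec, dotProduct_sum, Matrix.smul_mulVec _ (tpowW _),
      Matrix.smul_mulVec _ (permMatW _), dotProduct_smul, quadForm_tpowW _ (fun w => ψ w (x w)), quadForm_permMatW _ (fun w => ψ w (x w)),
      smul_eq_mul] at h
    push_cast
    simp only [hqC]
    exact h
  have hsq : ∀ x : W → Fin d, (∑ j, wgt j * ∏ w, q j w (x w)) ^ 2
      ≤ (t.factorial : ℝ) * ∑ π, γ (fixCountW π) ^ 2 * ‖c π x‖ ^ 2 := by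
    intro x
    calc (∑ j, wgt j * ∏ w, q j w (x w)) ^ 2
        = ‖((∑ j, wgt j * ∏ w, q j w (x w) : ℝ) : ℂ)‖ ^ 2 := by
          rw [Complex.norm_real, Real.norm_eq_abs, sq_abs]
      _ ≤ (∑ π, |γ (fixCountW π)| * ‖c π x‖) ^ 2 := by
          rw [hE]
          gcongr
          refine (norm_sum_le _ _).trans (le_of_eq ?_)
          simp
      _ ≤ _ := by
          refine sq_sum_le_card_mul_sum_sq.trans (le_of_eq ?_)
          rw [Finset.card_univ, Fintype.card_perm]
          simp only [mul_pow, sq_abs]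
          rfl
  have hterm : ∀ π : Equiv.Perm W,
      (1 / (d : ℝ)) ^ t * (γ (fixCountW π) ^ 2 * ∑ x, ‖c π x‖ ^ 2)
        ≤ (a ^ 2 / Real.sqrt d) ^ t := by
    intro π
    obtain ⟨n, hn, hle⟩ := sum_prod_doublyStochastic_le π.symm
      (fun w i j => ‖star (ψ w i) ⬝ᵥ ψ (π.symm w) j‖ ^ 2) (fun _ _ _ => by positivity)
      (fun w => (hψ w).sum_norm_sq_right (hψ _)) (fun w => (hψ w).sum_norm_sq_left (hψ _))
    rw [fixCountW_symm] at hn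
    have hf : fixCountW π ≤ t := Finset.card_le_univ _
    have hg : |γ (fixCountW π)| ≤ (a / Real.sqrt d) ^ fixCountW π := by
      rcases Nat.eq_zero_or_pos (fixCountW π) with h | h
      · simpa [h] using hγ0
      · exact hγ _ h hf
    refine le_trans ?_ (design_term_le hd ha hf hn hg)
    gcongr
    simpa only [hc, norm_prod, Finset.prod_pow] using hle
  calc _ = (1 / (d : ℝ)) ^ t * ∑ x : W → Fin d, (∑ j, wgt j * ∏ w, q j w (x w)) ^ 2 :=
        sum_sum_mul_prod_eq _ wgt q
    _ ≤ (1 / (d : ℝ)) ^ t * ∑ x : W → Fin d,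
          ((t.factorial : ℝ) * ∑ π, γ (fixCountW π) ^ 2 * ‖c π x‖ ^ 2) := by
        gcongr with x
        exact hsq x
    _ = (t.factorial : ℝ) * ∑ π : Equiv.Perm W,
          (1 / (d : ℝ)) ^ t * (γ (fixCountW π) ^ 2 * ∑ x, ‖c π x‖ ^ 2) := by
        rw [← Finset.mul_sum, Finset.sum_comm]
        simp only [← Finset.mul_sum]
        ring
    _ ≤ (t.factorial : ℝ) * ∑ _π : Equiv.Perm W, (a ^ 2 / Real.sqrt d) ^ t := by
        gcongr with π
        exact hterm π
    _ = _ := by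
        rw [Finset.sum_const, Finset.card_univ, Fintype.card_perm, nsmul_eq_mul]
        ring
end

section
/- Copy-wise low-degree hardness for non-adaptive single-copy measurements: let n, m, k ≥ 1, D ≥ 0, let μ be a finitely supported probability distribution over n-qubit density matrices, and for each i ∈ [m] let (φ^i_s)_{s ∈ {0,1}^n} be an orthonormal basis of ℂ^{2^n}. For a density matrix ρ and an orthonormal basis (φ_s), let D̄_ρ(s) = 2^n·⟨φ_s, ρ φ_s⟩, and let D̄_ρ^{≤D} be its projection, in L² of the uniform distribution on {0,1}^n, onto span{χ_S : |S| ≤ D}. Suppose that for every orthonormal basis (φ_s) of ℂ^{2^n} and every 1 ≤ t ≤ k: E_{ρ,ρ'∼μ i.i.d.}[ | ⟨D̄_ρ^{≤D}, D̄_{ρ'}^{≤D}⟩ − 1 |^t ] ≤ ε, where ⟨f,g⟩ = 2^{−n} Σ_s f(s)g(s). Then the m-copy likelihood ratio D̄_{ρ,m}(s_1,…,s_m) = ∏_{i=1}^m 2^n ⟨φ^i_{s_i}, ρ φ^i_{s_i}⟩ satisfies ‖ E_{ρ∼μ}[ D̄_{ρ,m}^{≤D,k} ] − 1 ‖² ≤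 k · m^k · ε, where f^{≤D,k} denotes the orthogonal projection, in L² of the uniform distribution on ({0,1}^n)^m, onto the span of the functions ∏_{i=1}^m χ_{S_i}(s_i) with every |S_i| ≤ D and at most k of the S_i nonempty, and ‖·‖ is the corresponding L² norm. -/
open Matrix BigOperators Finset
open scoped ComplexOrder

/-- The Fourier character `χ_S(s) = (−1)^{Σ_{j∈S} s_j}` on `{0,1}^n`. -/
def chiB {n : ℕ} (S : Finset (Fin n)) (s : Fin n → Fin 2) : ℝ :=
  (-1 : ℝ) ^ (∑ j ∈ S, (s j).val)

/-- The `L²` inner product with respect to the uniform distribution on `{0,1}^n`. -/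
noncomputable def innerB (n : ℕ) (f g : (Fin n → Fin 2) → ℝ) : ℝ :=
  ((2 : ℝ) ^ n)⁻¹ * ∑ s, f s * g s

/-- The orthogonal projection of `g : {0,1}^n → ℝ` onto `span{χ_S : |S| ≤ D}`. -/
noncomputable def truncD (n D : ℕ) (g : (Fin n → Fin 2) → ℝ) :
    (Fin n → Fin 2) → ℝ :=
  fun s => ∑ S : Finset (Fin n),
    if S.card ≤ D then innerB n g (chiB S) * chiB S s else 0

/-- The single-copy likelihood ratio `D̄_ρ(s) = 2^n·⟨φ_s, ρ φ_s⟩`. -/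
noncomputable def Dbar (n : ℕ) (φ : (Fin n → Fin 2) → (Fin n → Fin 2) → ℂ)
    (ρ : Matrix (Fin n → Fin 2) (Fin n → Fin 2) ℂ) : (Fin n → Fin 2) → ℝ :=
  fun s => (2 : ℝ) ^ n * (star (φ s) ⬝ᵥ (ρ *ᵥ φ s)).re

/-- The `m`-copy product character `∏_i χ_{S_i}(s_i)`. -/
def chiM {n m : ℕ} (S : Fin m → Finset (Fin n)) (s : Fin m → Fin n → Fin 2) : ℝ :=
  ∏ i, chiB (S i) (s i)

/-- The `L²` inner product with respect to the uniform distribution on `({0,1}^n)^m`. -/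
noncomputable def innerM (n m : ℕ) (F G : (Fin m → Fin n → Fin 2) → ℝ) : ℝ :=
  ((2 : ℝ) ^ (m * n))⁻¹ * ∑ s, F s * G s

/-- Orthogonal projection onto sample-wise degree `(D,k)` functions. -/
noncomputable def truncDk (n m D k : ℕ) (F : (Fin m → Fin n → Fin 2) → ℝ) :
    (Fin m → Fin n → Fin 2) → ℝ :=
  fun s => ∑ S : Fin m → Finset (Fin n),
    if (∀ i, (S i).card ≤ D) ∧ (Finset.univ.filter fun i => S i ≠ ∅).card ≤ k then
      innerM n m F (chiM S) * chiM S s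
    else 0

/-- The `m`-copy likelihood ratio `D̄_{ρ,m}(s) = ∏_i D̄^{(i)}_ρ(s_i)`. -/
noncomputable def DbarM (n m : ℕ)
    (φ : Fin m → (Fin n → Fin 2) → (Fin n → Fin 2) → ℂ)
    (ρ : Matrix (Fin n → Fin 2) (Fin n → Fin 2) ℂ) : (Fin m → Fin n → Fin 2) → ℝ :=
  fun s => ∏ i, Dbar n (φ i) ρ (s i)

/-- The sum of a product function over a finite product is the product of the sums. -/
lemma sum_prod_pi {m : ℕ} {α : Type*} [Fintype α] (f : Fin m → α → ℝ) :
    ∑ s : Fin m → α, ∏ i, f i (s i) = ∏ i, ∑ a, f i a := by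
  classical
  rw [Finset.prod_univ_sum, Fintype.piFinset_univ]

lemma chiB_eq_prod {n : ℕ} (S : Finset (Fin n)) (s : Fin n → Fin 2) :
    chiB S s = ∏ j, if j ∈ S then (-1 : ℝ) ^ (s j).val else 1 := by
  simp [chiB, Finset.prod_pow_eq_pow_sum]

lemma chiB_empty {n : ℕ} (s : Fin n → Fin 2) : chiB ∅ s = 1 := by
  simp [chiB]

/-- Orthonormality of the characters on `{0,1}^n`. -/
lemma innerB_chiB {n : ℕ} (S T : Finset (Fin n)) :
    innerB n (chiB S) (chiB T) = if S = T then 1 else 0 := by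
  unfold innerB
  simp_rw [chiB_eq_prod, ← Finset.prod_mul_distrib]
  rw [sum_prod_pi (fun j (a : Fin 2) =>
    (if j ∈ S then (-1 : ℝ) ^ a.val else 1) * (if j ∈ T then (-1 : ℝ) ^ a.val else 1))]
  split_ifs with h
  · subst h
    have : ∀ j : Fin n, ∑ a : Fin 2, (if j ∈ S then (-1 : ℝ) ^ a.val else 1) *
        (if j ∈ S then (-1 : ℝ) ^ a.val else 1) = 2 := by
      intro j
      by_cases hj : j ∈ S <;> simp [hj] <;> norm_num
    rw [Finset.prod_congr rfl fun j _ => this j]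
    simp
  · obtain ⟨j, hj⟩ : ∃ j, ¬ (j ∈ S ↔ j ∈ T) := by
      by_contra! hc
      exact h (Finset.ext hc)
    rw [Finset.prod_eq_zero (Finset.mem_univ j), mul_zero]
    by_cases h1 : j ∈ S <;> by_cases h2 : j ∈ T <;> simp_all

/-- The `m`-copy inner product of product functions factorizes. -/
lemma innerM_prod {n m : ℕ} (f g : Fin m → (Fin n → Fin 2) → ℝ) :
    innerM n m (fun s => ∏ i, f i (s i)) (fun s => ∏ i, g i (s i)) =
      ∏ i, innerB n (f i) (g i) := by
  unfold innerM innerB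
  simp_rw [← Finset.prod_mul_distrib]
  rw [sum_prod_pi (fun i a => f i a * g i a), Finset.prod_mul_distrib]
  simp [pow_mul, mul_comm m n]

/-- Orthonormality of the product characters on `({0,1}^n)^m`. -/
lemma innerM_chiM {n m : ℕ} (S T : Fin m → Finset (Fin n)) :
    innerM n m (chiM S) (chiM T) = if S = T then 1 else 0 := by
  have h := innerM_prod (fun i => chiB (S i)) (fun i => chiB (T i))
  simp_rw [innerB_chiB] at h
  rw [show chiM S = fun s => ∏ i, chiB (S i) (s i) from rfl,
    show chiM T = fun s => ∏ i, chiB (T i) (s i) from rfl, h]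
  split_ifs with hST
  · simp [hST]
  · obtain ⟨i, hi⟩ := Function.ne_iff.mp hST
    exact Finset.prod_eq_zero (Finset.mem_univ i) (by simp [hi])

/-- Parseval's identity for combinations of product characters. -/
lemma innerM_sum_chiM {n m : ℕ} (A : Finset (Fin m → Finset (Fin n)))
    (b : (Fin m → Finset (Fin n)) → ℝ) :
    innerM n m (fun s => ∑ S ∈ A, b S * chiM S s) (fun s => ∑ S ∈ A, b S * chiM S s) =
      ∑ S ∈ A, b S ^ 2 := by
  have h : innerM n m (fun s => ∑ S ∈ A, b S * chiM S s) (fun s => ∑ S ∈ A, b S * chiM S s) =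
      ∑ S ∈ A, ∑ T ∈ A, b S * b T * innerM n m (chiM S) (chiM T) := by
    unfold innerM
    simp_rw [Finset.sum_mul_sum, Finset.mul_sum]
    rw [Finset.sum_comm]
    refine Finset.sum_congr rfl fun S _ => ?_
    rw [Finset.sum_comm]
    refine Finset.sum_congr rfl fun T _ => Finset.sum_congr rfl fun s _ => ?_
    ring
  rw [h]
  refine Finset.sum_congr rfl fun S hS => ?_
  simp [innerM_chiM, hS, sq]

/-- The inner product of two truncations in terms of Fourier coefficients. -/
lemma innerB_truncD {n D : ℕ} (f g : (Fin n → Fin 2) → ℝ) :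
    innerB n (truncD n D f) (truncD n D g) =
      ∑ S with S.card ≤ D, innerB n f (chiB S) * innerB n g (chiB S) := by
  have h : innerB n (truncD n D f) (truncD n D g) =
      ∑ S with S.card ≤ D, ∑ T with T.card ≤ D, innerB n f (chiB S) * innerB n g (chiB T) *
        innerB n (chiB S) (chiB T) := by
    unfold truncD
    generalize innerB n f = a
    generalize innerB n g = b
    simp_rw [← Finset.sum_filter]
    unfold innerB
    simp_rw [Finset.sum_mul_sum, Finset.mul_sum]
    rw [Finset.sum_comm]
    refine Finset.sum_congr rfl fun S _ => ?_
    rw [Finset.sum_comm]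
    refine Finset.sum_congr rfl fun T _ => Finset.sum_congr rfl fun s _ => ?_
    ring
  rw [h]
  refine Finset.sum_congr rfl fun S hS => ?_
  simp only [innerB_chiB, mul_ite, mul_one, mul_zero]
  rw [Finset.sum_ite_eq, if_pos hS]

/-- An orthonormal basis computes the trace. -/
lemma IsONB.sum_dotProduct_mulVec {ι : Type*} [Fintype ι] [DecidableEq ι] {φ : ι → ι → ℂ}
    (hφ : IsONB φ) (A : Matrix ι ι ℂ) : ∑ s, star (φ s) ⬝ᵥ (A *ᵥ φ s) = A.trace := by
  let U : Matrix ι ι ℂ := Matrix.of fun s a => star (φ s a)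
  have hU : U * Uᴴ = 1 := by
    ext s t
    simpa [U, Matrix.mul_apply, Matrix.one_apply, dotProduct] using hφ s t
  have hU' : Uᴴ * U = 1 := mul_eq_one_comm.mp hU
  have h : ∑ s, star (φ s) ⬝ᵥ (A *ᵥ φ s) = (U * (A * Uᴴ)).trace := by
    simp [U, Matrix.trace, Matrix.mul_apply, dotProduct, mulVec]
  rw [h, Matrix.trace_mul_comm, Matrix.mul_assoc, hU', Matrix.mul_one]

/-- The likelihood ratio of a unit-trace matrix has mean one. -/
lemma innerB_Dbar_chiB_empty {n : ℕ} {φ : (Fin n → Fin 2) → (Fin n → Fin 2) → ℂ}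
    (hφ : IsONB φ) {ρ : Matrix (Fin n → Fin 2) (Fin n → Fin 2) ℂ} (hρ : ρ.trace = 1) :
    innerB n (Dbar n φ ρ) (chiB ∅) = 1 := by
  unfold innerB Dbar
  simp_rw [chiB_empty, mul_one]
  rw [← Finset.mul_sum, ← Complex.re_sum, hφ.sum_dotProduct_mulVec, hρ]
  simp

/-- The set of copies on which a family of frequencies is nonempty. -/
def copySupport {n m : ℕ} (S : Fin m → Finset (Fin n)) : Finset (Fin m) :=
  Finset.univ.filter fun i => S i ≠ ∅

/-- Summing a product over the families of frequencies of degree at most `D` with a given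
support, when each factor takes the value one at the empty frequency. -/
lemma sum_prod_copySupport_eq {n m D : ℕ} (T : Finset (Fin m))
    (f : Fin m → Finset (Fin n) → ℝ) (hf : ∀ i, f i ∅ = 1) :
    ∑ S : Fin m → Finset (Fin n) with (∀ i, (S i).card ≤ D) ∧ copySupport S = T,
      ∏ i, f i (S i) = ∏ i ∈ T, ((∑ R with R.card ≤ D, f i R) - 1) := by
  let P : Fin m → Finset (Finset (Fin n)) := fun i =>
    if i ∈ T then (Finset.univ.filter fun R => R.card ≤ D).erase ∅ else {∅}
  have hP : (Finset.univ.filter fun S : Fin m → Finset (Fin n) =>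
      (∀ i, (S i).card ≤ D) ∧ copySupport S = T) = Fintype.piFinset P := by
    ext S
    simp only [Finset.mem_filter, Finset.mem_univ, true_and, Fintype.mem_piFinset, copySupport,
      Finset.ext_iff (s₂ := T), P]
    rw [← forall_and]
    refine forall_congr' fun i => ?_
    by_cases hi : i ∈ T
    · simp [hi, and_comm]
    · simp only [hi, iff_false, not_not, if_false, Finset.mem_singleton]
      constructor
      · exact fun h => h.2
      · intro h
        simp [h]
  rw [hP, ← Finset.prod_univ_sum, ← Finset.prod_subset (Finset.subset_univ T)]
  · refine Finset.prod_congr rfl fun i hi => ?_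
    simp only [P, hi, if_true]
    rw [Finset.sum_erase_eq_sub (by simp), hf]
  · intro i _ hi
    simp [P, hi, hf]

/-- The arithmetic–geometric mean inequality for a product of real numbers. -/
lemma prod_le_mean_abs_pow {ι : Type*} (T : Finset ι) (hT : T.Nonempty) (x : ι → ℝ) :
    ∏ i ∈ T, x i ≤ (T.card : ℝ)⁻¹ * ∑ i ∈ T, |x i| ^ T.card := by
  have hc : T.card ≠ 0 := hT.card_pos.ne'
  have h := Real.geom_mean_le_arith_mean_weighted T (fun _ => (T.card : ℝ)⁻¹)
    (fun i => |x i| ^ T.card) (fun _ _ => by positivity)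
    (by simp [hc]) (fun _ _ => by positivity)
  simp_rw [Real.pow_rpow_inv_natCast (abs_nonneg _) hc, ← Finset.mul_sum] at h
  rw [← Finset.abs_prod] at h
  exact (le_abs_self _).trans h

/-- There are at most `k * m ^ k` nonempty subsets of `Fin m` of size at most `k`. -/
lemma card_nonempty_card_le {m k : ℕ} (hm : 1 ≤ m) :
    (Finset.univ.filter fun T : Finset (Fin m) => T.Nonempty ∧ T.card ≤ k).card ≤
      k * m ^ k := by
  have h : (Finset.univ.filter fun T : Finset (Fin m) => T.Nonempty ∧ T.card ≤ k) ⊆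
      (Finset.Icc 1 k).biUnion fun t => Finset.powersetCard t Finset.univ := by
    intro T hT
    simp only [Finset.mem_filter, Finset.mem_univ, true_and] at hT
    simp [Finset.mem_powersetCard, hT.2, hT.1]
  refine (Finset.card_le_card h).trans (Finset.card_biUnion_le.trans ?_)
  calc ∑ t ∈ Finset.Icc 1 k, (Finset.powersetCard t (Finset.univ : Finset (Fin m))).card
      ≤ ∑ t ∈ Finset.Icc 1 k, m ^ k := by
        refine Finset.sum_le_sum fun t ht => ?_
        rw [Finset.card_powersetCard, Finset.card_univ, Fintype.card_fin]
        exact (Nat.choose_le_pow m t).trans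
          (Nat.pow_le_pow_right hm (Finset.mem_Icc.mp ht).2)
    _ = k * m ^ k := by simp

/-- copy-wise low-degree hardness for non-adaptive single-copy
measurements. -/
theorem copywise_low_degree_hardness
    (n m k D : ℕ) (hn : 1 ≤ n) (hm : 1 ≤ m) (hk : 1 ≤ k) (ε : ℝ)
    (J : Type) [Fintype J] (w : J → ℝ) (hw0 : ∀ j, 0 ≤ w j) (hw1 : ∑ j, w j = 1)
    (ρ : J → Matrix (Fin n → Fin 2) (Fin n → Fin 2) ℂ)
    (hρ : ∀ j, (ρ j).PosSemidef) (htrρ : ∀ j, (ρ j).trace = 1)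
    (φ : Fin m → (Fin n → Fin 2) → (Fin n → Fin 2) → ℂ) (hφ : ∀ i, IsONB (φ i))
    (hbound : ∀ φ₀ : (Fin n → Fin 2) → (Fin n → Fin 2) → ℂ, IsONB φ₀ →
      ∀ t : ℕ, 1 ≤ t → t ≤ k →
        ∑ j, ∑ j', w j * w j' *
            |innerB n (truncD n D (Dbar n φ₀ (ρ j)))
                (truncD n D (Dbar n φ₀ (ρ j'))) - 1| ^ t ≤ ε) :
    innerM n m
        (fun s => (∑ j, w j * truncDk n m D k (DbarM n m φ (ρ j)) s) - 1)
        (fun s => (∑ j, w j * truncDk n m D k (DbarM n m φ (ρ j)) s) - 1)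
      ≤ (k : ℝ) * (m : ℝ) ^ k * ε := by
  let c : Fin m → J → Finset (Fin n) → ℝ := fun i j R => innerB n (Dbar n (φ i) (ρ j)) (chiB R)
  have hc : ∀ i j, c i j ∅ = 1 := fun i j => innerB_Dbar_chiB_empty (hφ i) (htrρ j)
  let X : J → J → Fin m → ℝ := fun j j' i => (∑ R with R.card ≤ D, c i j R * c i j' R) - 1
  have hX : ∀ i j j', innerB n (truncD n D (Dbar n (φ i) (ρ j)))
      (truncD n D (Dbar n (φ i) (ρ j'))) - 1 = X j j' i := fun i j j' => by
    rw [innerB_truncD]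
  have hmoment : ∀ i t, 1 ≤ t → t ≤ k → ∑ j, ∑ j', w j * w j' * |X j j' i| ^ t ≤ ε := by
    intro i t h1 h2
    have h := hbound (φ i) (hφ i) t h1 h2
    simpa only [hX] using h
  have hε : 0 ≤ ε := by
    refine le_trans ?_ (hmoment ⟨0, hm⟩ 1 le_rfl hk)
    exact Finset.sum_nonneg fun j _ => Finset.sum_nonneg fun j' _ =>
      mul_nonneg (mul_nonneg (hw0 j) (hw0 j')) (by positivity)
  let A : Finset (Fin m → Finset (Fin n)) :=
    Finset.univ.filter fun S => (∀ i, (S i).card ≤ D) ∧ (copySupport S).card ≤ k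
  let b : (Fin m → Finset (Fin n)) → ℝ := fun S => ∑ j, w j * ∏ i, c i j (S i)
  let E : Fin m → Finset (Fin n) := fun _ => ∅
  have hEA : E ∈ A := by simp [A, E, copySupport]
  have hbE : b E = 1 := by simp [b, E, hc, hw1]
  have hexpand : (fun s => (∑ j, w j * truncDk n m D k (DbarM n m φ (ρ j)) s) - 1) =
      fun s => ∑ S ∈ A.erase E, b S * chiM S s := by
    funext s
    rw [Finset.sum_erase_eq_sub hEA, hbE]
    have hchi : chiM E s = 1 := by simp [chiM, E, chiB_empty]
    rw [hchi, one_mul]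
    congr 1
    have hcoef : ∀ j S, innerM n m (DbarM n m φ (ρ j)) (chiM S) = ∏ i, c i j (S i) :=
      fun j S => innerM_prod (fun i => Dbar n (φ i) (ρ j)) (fun i => chiB (S i))
    unfold truncDk
    simp_rw [hcoef, ← Finset.sum_filter, Finset.mul_sum, b, Finset.sum_mul]
    rw [Finset.sum_comm]
    refine Finset.sum_congr ?_ fun S _ => Finset.sum_congr rfl fun j _ => (mul_assoc _ _ _).symm
    ext S
    simp [A, copySupport]
  rw [hexpand, innerM_sum_chiM]
  let B : Finset (Finset (Fin m)) := Finset.univ.filter fun T => T.Nonempty ∧ T.card ≤ k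
  have hmaps : ∀ S ∈ A.erase E, copySupport S ∈ B := by
    intro S hS
    simp only [A, Finset.mem_erase, Finset.mem_filter, Finset.mem_univ, true_and] at hS
    simp only [B, Finset.mem_filter, Finset.mem_univ, true_and]
    refine ⟨?_, hS.2.2⟩
    obtain ⟨i, hi⟩ := Function.ne_iff.mp hS.1
    exact ⟨i, by simpa [copySupport, E] using hi⟩
  have hfiber : ∀ T ∈ B, ((A.erase E).filter fun S => copySupport S = T) =
      Finset.univ.filter fun S : Fin m → Finset (Fin n) =>
        (∀ i, (S i).card ≤ D) ∧ copySupport S = T := by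
    intro T hT
    simp only [B, Finset.mem_filter, Finset.mem_univ, true_and] at hT
    ext S
    simp only [A, Finset.mem_erase, Finset.mem_filter, Finset.mem_univ, true_and]
    constructor
    · exact fun h => ⟨h.1.2.1, h.2⟩
    · rintro ⟨h1, rfl⟩
      refine ⟨⟨?_, h1, hT.2⟩, rfl⟩
      rintro rfl
      simp [copySupport, E] at hT
  have hbsq : ∀ S, b S ^ 2 = ∑ j, ∑ j', w j * w j' * ∏ i, c i j (S i) * c i j' (S i) := by
    intro S
    simp only [b, sq, Finset.sum_mul_sum, Finset.prod_mul_distrib]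
    exact Finset.sum_congr rfl fun j _ => Finset.sum_congr rfl fun j' _ => by ring
  have hT : ∀ T ∈ B, ∑ S ∈ A.erase E with copySupport S = T, b S ^ 2 ≤ ε := by
    intro T hT
    rw [hfiber T hT]
    simp only [B, Finset.mem_filter, Finset.mem_univ, true_and] at hT
    have hcard : (T.card : ℝ) ≠ 0 := by exact_mod_cast hT.1.card_pos.ne'
    calc _ = ∑ j, ∑ j', w j * w j' * ∏ i ∈ T, X j j' i := by
          simp_rw [hbsq]
          rw [Finset.sum_comm]
          refine Finset.sum_congr rfl fun j _ => ?_
          rw [Finset.sum_comm]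
          refine Finset.sum_congr rfl fun j' _ => ?_
          rw [← Finset.mul_sum, sum_prod_copySupport_eq T (fun i R => c i j R * c i j' R)
            (fun i => by simp [hc])]
      _ ≤ ∑ j, ∑ j', w j * w j' * ((T.card : ℝ)⁻¹ * ∑ i ∈ T, |X j j' i| ^ T.card) :=
          Finset.sum_le_sum fun j _ => Finset.sum_le_sum fun j' _ =>
            mul_le_mul_of_nonneg_left (prod_le_mean_abs_pow T hT.1 _)
              (mul_nonneg (hw0 j) (hw0 j'))
      _ = (T.card : ℝ)⁻¹ * ∑ i ∈ T, ∑ j, ∑ j', w j * w j' * |X j j' i| ^ T.card := by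
          rw [Finset.sum_comm (s := T), Finset.mul_sum]
          refine Finset.sum_congr rfl fun j _ => ?_
          rw [Finset.sum_comm (s := T), Finset.mul_sum]
          refine Finset.sum_congr rfl fun j' _ => ?_
          rw [← Finset.mul_sum]
          ring
      _ ≤ (T.card : ℝ)⁻¹ * ∑ i ∈ T, ε := by
          gcongr with i hi
          exact hmoment i _ hT.1.card_pos hT.2
      _ = ε := by
          rw [Finset.sum_const, nsmul_eq_mul, inv_mul_cancel_left₀ hcard]
  rw [← Finset.sum_fiberwise_of_maps_to hmaps]
  calc _ ≤ ∑ T ∈ B, ε := Finset.sum_le_sum hT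
    _ = (B.card : ℝ) * ε := by rw [Finset.sum_const, nsmul_eq_mul]
    _ ≤ (k : ℝ) * (m : ℝ) ^ k * ε := by
        gcongr
        exact_mod_cast card_nonempty_card_le hm
end
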